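/- arXiv:1402.3485 — 2 statements merged into one kernel-verified Lean document; each statement's English description precedes it below -/
import Mathlib

section
/- For α, β ≥ -1 and each integer l ≥ 1: lim_{n→∞} n^l · T_{n,2l}^{α,β}(x) = (2l-1)!! · (x(1-x))^l, uniformly for x ∈ [0,1]. -/
open MeasureTheory intervalIntegral Filter

/-- The Beta operator with Jacobi weights: `B_n^{α,β}(f;x)`. -/
noncomputable def Bop (n α β : ℝ) (f : ℝ → ℝ) (x : ℝ) : ℝ :=
  (∫ t in (0:ℝ)..1, t ^ (n * x + α) * (1 - t) ^ (n - n * x + β) * f t) /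
  (∫ t in (0:ℝ)..1, t ^ (n * x + α) * (1 - t) ^ (n - n * x + β))

/-- The `m`-th central moment `T_{n,m}^{α,β}(x)`. -/
noncomputable def T (n α β : ℝ) (m : ℕ) (x : ℝ) : ℝ :=
  Bop n α β (fun t => (t - x) ^ m) x


/-- The Beta operator extended to the limiting cases `α = -1` (interpolation at `0`)
and `β = -1` (interpolation at `1`). -/
noncomputable def BopE (n α β : ℝ) (f : ℝ → ℝ) (x : ℝ) : ℝ :=
  if α = -1 ∧ x = 0 then f 0
  else if β = -1 ∧ x = 1 then f 1
  else Bop n α β f x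

/-- The `m`-th central moment of the extended Beta operator. -/
noncomputable def TE (n α β : ℝ) (m : ℕ) (x : ℝ) : ℝ :=
  BopE n α β (fun t => (t - x) ^ m) x

open Set in
theorem intervalIntegrable_rpow_mul_one_sub_rpow {p q : ℝ} (hp : -1 < p) (hq : -1 < q) :
    IntervalIntegrable (fun t : ℝ => t ^ p * (1 - t) ^ q) volume 0 1 := by
  have left : ∀ {p q : ℝ}, -1 < p →
      IntervalIntegrable (fun t : ℝ => t ^ p * (1 - t) ^ q) volume 0 (1 / 2) := by
    intro p q hp
    refine (intervalIntegrable_rpow' hp).mul_continuousOn ?_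
    intro t ht
    rw [uIcc_of_le (by norm_num)] at ht
    refine ContinuousAt.continuousWithinAt (ContinuousAt.rpow_const (by fun_prop) (Or.inl ?_))
    linarith [ht.2]
  refine (left hp).trans ?_
  have h := ((@left q p hq).comp_sub_left 1).symm
  norm_num at h
  refine h.congr ?_
  intro t _
  simp [mul_comm]

/-- The three-term recurrence of the central moments of the Beta weight, before normalization. -/
theorem integral_beta_weight_recurrence {p q : ℝ} (hp : -1 < p) (hq : -1 < q) (x : ℝ) (m : ℕ) :
    (p + q + 2 + m) * (∫ t in (0:ℝ)..1, t ^ p * (1 - t) ^ q * (t - x) ^ (m + 1)) =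
      (p + 1 - (p + q + 2) * x + m * (1 - 2 * x)) *
          (∫ t in (0:ℝ)..1, t ^ p * (1 - t) ^ q * (t - x) ^ m) +
        m * (x * (1 - x)) * (∫ t in (0:ℝ)..1, t ^ p * (1 - t) ^ q * (t - x) ^ (m - 1)) := by
  have hint : ∀ k : ℕ, IntervalIntegrable
      (fun t : ℝ => t ^ p * (1 - t) ^ q * (t - x) ^ k) volume 0 1 := fun k =>
    (intervalIntegrable_rpow_mul_one_sub_rpow hp hq).mul_continuousOn (by fun_prop)
  have hint' := (((hint m).const_mul (p + 1 - (p + q + 2) * x + m * (1 - 2 * x))).add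
    ((hint (m - 1)).const_mul (m * (x * (1 - x))))).sub
    ((hint (m + 1)).const_mul (p + q + 2 + m))
  have hcont : ContinuousOn
      (fun t : ℝ => t ^ (p + 1) * (1 - t) ^ (q + 1) * (t - x) ^ m) (Set.Icc 0 1) := by
    have h1 : Continuous fun t : ℝ => t ^ (p + 1) :=
      Real.continuous_rpow_const (by linarith)
    have h2 : Continuous fun t : ℝ => (1 - t) ^ (q + 1) :=
      (Real.continuous_rpow_const (by linarith)).comp (continuous_const.sub continuous_id)
    exact ((h1.mul h2).mul (by fun_prop)).continuousOn
  have key := integral_eq_sub_of_hasDerivAt_of_le zero_le_one hcont (fun t ht => ?_) hint'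
  · rw [Real.zero_rpow (by linarith), sub_self, Real.zero_rpow (by linarith),
      intervalIntegral.integral_sub (((hint m).const_mul _).add ((hint (m - 1)).const_mul _))
        ((hint (m + 1)).const_mul _),
      intervalIntegral.integral_add ((hint m).const_mul _) ((hint (m - 1)).const_mul _)] at key
    simp only [intervalIntegral.integral_const_mul] at key
    linarith
  · have ht0 : 0 < t := ht.1
    have ht1 : 0 < 1 - t := by linarith [ht.2]
    have d1 : HasDerivAt (fun t : ℝ => t ^ (p + 1)) ((p + 1) * t ^ p) t := by
      simpa using Real.hasDerivAt_rpow_const (p := p + 1) (Or.inl ht0.ne')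
    have d2 : HasDerivAt (fun t : ℝ => (1 - t) ^ (q + 1)) (-((q + 1) * (1 - t) ^ q)) t := by
      convert! ((hasDerivAt_id t).const_sub 1).rpow_const (p := q + 1) (Or.inl ht1.ne') using 1
      simp only [id, add_sub_cancel_right]
      ring
    have d3 : HasDerivAt (fun t : ℝ => (t - x) ^ m) (m * (t - x) ^ (m - 1)) t := by
      convert! ((hasDerivAt_id t).sub_const x).pow m using 1
      simp
    convert! (d1.mul d2).mul d3 using 1
    simp only [Pi.mul_apply]
    rw [Real.rpow_add_one ht0.ne', Real.rpow_add_one ht1.ne']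
    rcases m with _ | m
    · simp; ring
    · simp only [Nat.add_sub_cancel, pow_succ]; push_cast; ring

/-- Away from the interpolation case, the exponent at an endpoint is integrable. -/
theorem neg_one_lt_mul_add {n a y : ℝ} (hn : 0 < n) (ha : -1 ≤ a) (hy : 0 ≤ y)
    (h : ¬(a = -1 ∧ y = 0)) : -1 < n * y + a := by
  rcases ha.lt_or_eq with ha | rfl
  · have := mul_nonneg hn.le hy
    linarith
  · have : 0 < y := hy.lt_of_ne' fun hy => h ⟨rfl, hy⟩
    have := mul_pos hn this
    linarith

theorem neg_one_lt_sub_mul_add {n a x : ℝ} (hn : 0 < n) (ha : -1 ≤ a) (hx : x ≤ 1)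
    (h : ¬(a = -1 ∧ x = 1)) : -1 < n - n * x + a := by
  have := neg_one_lt_mul_add (y := 1 - x) hn ha (by linarith)
    fun h' => h ⟨h'.1, by linarith [h'.2]⟩
  linarith

theorem TE_zero {n α β x : ℝ} (hn : 0 < n) (hα : -1 ≤ α) (hβ : -1 ≤ β)
    (hx : x ∈ Set.Icc (0:ℝ) 1) : TE n α β 0 x = 1 := by
  by_cases h0 : α = -1 ∧ x = 0
  · simp [TE, BopE, h0]
  by_cases h1 : β = -1 ∧ x = 1
  · simp [TE, BopE, h1]
  have hpos := intervalIntegral_pos_of_pos_on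
    (intervalIntegrable_rpow_mul_one_sub_rpow (neg_one_lt_mul_add hn hα hx.1 h0)
      (neg_one_lt_sub_mul_add hn hβ hx.2 h1))
    (fun t ht => mul_pos (Real.rpow_pos_of_pos ht.1 _)
      (Real.rpow_pos_of_pos (sub_pos.2 ht.2) _)) one_pos
  simp only [TE, BopE, if_neg h0, if_neg h1, Bop, pow_zero, mul_one]
  exact div_self hpos.ne'

theorem TE_recurrence {n α β x : ℝ} (hn : 0 < n) (hα : -1 ≤ α) (hβ : -1 ≤ β)
    (hx : x ∈ Set.Icc (0:ℝ) 1) (m : ℕ) :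
    (n + α + β + 2 + m) * TE n α β (m + 1) x =
      (α + 1 - (α + β + 2) * x + m * (1 - 2 * x)) * TE n α β m x +
        m * (x * (1 - x)) * TE n α β (m - 1) x := by
  by_cases h0 : α = -1 ∧ x = 0
  · rcases m with _ | m <;> simp [TE, BopE, h0]
  by_cases h1 : β = -1 ∧ x = 1
  · rcases m with _ | m
    · simp [TE, BopE, h1]
      ring
    · simp [TE, BopE, h1]
  have key := integral_beta_weight_recurrence (neg_one_lt_mul_add hn hα hx.1 h0)
    (neg_one_lt_sub_mul_add hn hβ hx.2 h1) x m
  simp only [TE, BopE, if_neg h0, if_neg h1, Bop, ← mul_div_assoc, ← add_div]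
  congr 1
  convert key using 2 <;> ring

open Asymptotics Topology in
theorem central_moment_asymptotics {α β : ℝ} (hα : -1 ≤ α) (hβ : -1 ≤ β) (l : ℕ) :
    (fun z : ℕ × ℝ => (z.1 : ℝ) ^ l * TE z.1 α β (2 * l) z.2 -
        (Nat.doubleFactorial (2 * l - 1) : ℝ) * (z.2 * (1 - z.2)) ^ l)
      =o[atTop ×ˢ 𝓟 (Set.Icc (0:ℝ) 1)] (fun _ => (1:ℝ)) ∧
    (fun z : ℕ × ℝ => (z.1 : ℝ) ^ l * TE z.1 α β (2 * l + 1) z.2)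
      =o[atTop ×ˢ 𝓟 (Set.Icc (0:ℝ) 1)] (fun _ => (1:ℝ)) := by
  set L : Filter (ℕ × ℝ) := atTop ×ˢ 𝓟 (Set.Icc (0:ℝ) 1) with hL
  have hbdd : ∀ f : ℝ → ℝ, Continuous f →
      (fun z : ℕ × ℝ => f z.2) =O[L] (fun _ => (1:ℝ)) := by
    intro f hf
    obtain ⟨C, hC⟩ := isCompact_Icc.exists_bound_of_continuousOn (s := Set.Icc (0:ℝ) 1)
      hf.continuousOn
    refine IsBigO.of_bound C ?_
    rw [hL, eventually_prod_principal_iff]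
    exact Eventually.of_forall fun n x hx => by simpa using hC x hx
  have hev : ∀ᶠ z : ℕ × ℝ in L, 0 < (z.1 : ℝ) ∧ z.2 ∈ Set.Icc (0:ℝ) 1 := by
    rw [hL, eventually_prod_principal_iff]
    filter_upwards [eventually_gt_atTop 0] with n hn x hx
    exact ⟨by exact_mod_cast hn, hx⟩
  have hcast : Tendsto (fun z : ℕ × ℝ => (z.1 : ℝ)) L atTop :=
    tendsto_natCast_atTop_atTop.comp tendsto_fst
  have hinv : ∀ s : ℝ, (fun z : ℕ × ℝ => ((z.1 : ℝ) + s)⁻¹) =o[L] (fun _ => (1:ℝ)) := fun s =>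
    (isLittleO_one_iff ℝ).2 (tendsto_inv_atTop_zero.comp (tendsto_atTop_add_const_right _ s hcast))
  have hratio : ∀ s : ℝ,
      (fun z : ℕ × ℝ => (z.1 : ℝ) / (z.1 + s) - 1) =o[L] (fun _ => (1:ℝ)) := fun s => by
    refine ((hinv s).const_mul_left (-s)).congr' ?_ EventuallyEq.rfl
    filter_upwards [(tendsto_atTop_add_const_right _ s hcast).eventually_gt_atTop 0] with z hz
    field_simp
    ring
  have hratio' : ∀ s : ℝ,
      (fun z : ℕ × ℝ => (z.1 : ℝ) / (z.1 + s)) =O[L] (fun _ => (1:ℝ)) := fun s =>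
    ((hratio s).isBigO.add (isBigO_refl _ _)).congr_left fun z => by ring
  have hmul : ∀ {f g : ℕ × ℝ → ℝ}, f =O[L] (fun _ => (1:ℝ)) → g =o[L] (fun _ => (1:ℝ)) →
      (fun z => f z * g z) =o[L] (fun _ => (1:ℝ)) := fun hf hg => by
    simpa using hf.mul_isLittleO hg
  have hMul : ∀ {f g : ℕ × ℝ → ℝ}, f =O[L] (fun _ => (1:ℝ)) → g =O[L] (fun _ => (1:ℝ)) →
      (fun z => f z * g z) =O[L] (fun _ => (1:ℝ)) := fun hf hg => by
    simpa using hf.mul hg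
  have hrec : ∀ m : ℕ, ∀ᶠ z : ℕ × ℝ in L, 0 < (z.1 : ℝ) + (α + β + 2 + m) ∧
      TE z.1 α β (m + 1) z.2 = ((α + 1 - (α + β + 2) * z.2 + m * (1 - 2 * z.2)) *
        TE z.1 α β m z.2 + m * (z.2 * (1 - z.2)) * TE z.1 α β (m - 1) z.2) /
          (z.1 + (α + β + 2 + m)) := by
    intro m
    filter_upwards [hev] with z hz
    have hpos : 0 < (z.1 : ℝ) + (α + β + 2 + m) := by
      have := hz.1
      have : (0:ℝ) ≤ m := m.cast_nonneg
      linarith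
    refine ⟨hpos, ?_⟩
    rw [eq_div_iff hpos.ne', ← TE_recurrence hz.1 hα hβ hz.2 m]
    ring
  induction l with
  | zero =>
    have h0 : ∀ᶠ z : ℕ × ℝ in L, TE z.1 α β 0 z.2 = 1 := by
      filter_upwards [hev] with z hz using TE_zero hz.1 hα hβ hz.2
    constructor
    · refine (isLittleO_zero (fun _ => (1:ℝ)) L).congr' ?_ EventuallyEq.rfl
      filter_upwards [h0] with z hz
      simp [hz]
    · refine (hmul (hbdd (fun x => α + 1 - (α + β + 2) * x) (by fun_prop))
        (hinv (α + β + 2))).congr' ?_ EventuallyEq.rfl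
      filter_upwards [h0, hrec 0] with z hz hr
      simp only [Nat.cast_zero, add_zero, zero_add, zero_mul, hz] at hr
      simp [hr.2, div_eq_mul_inv]
  | succ l ih =>
    obtain ⟨ihe, iho⟩ := ih
    set d : ℝ := (Nat.doubleFactorial (2 * l - 1) : ℝ) with hd
    have hd' : (Nat.doubleFactorial (2 * (l + 1) - 1) : ℝ) = (2 * l + 1) * d := by
      rcases l with _ | l
      · simp [hd]
      · rw [hd, show 2 * (l + 1 + 1) - 1 = (2 * l + 1) + 2 by omega,
          show 2 * (l + 1) - 1 = 2 * l + 1 by omega, Nat.doubleFactorial_add_two]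
        push_cast
        ring
    have heven : (fun z : ℕ × ℝ => (z.1 : ℝ) ^ (l + 1) * TE z.1 α β (2 * (l + 1)) z.2 -
        (Nat.doubleFactorial (2 * (l + 1) - 1) : ℝ) * (z.2 * (1 - z.2)) ^ (l + 1))
        =o[L] (fun _ => (1:ℝ)) := by
      set s : ℝ := α + β + 2 + (2 * l + 1 : ℕ) with hs
      have e1 := hmul (hMul (hratio' s) (hbdd (fun x => α + 1 - (α + β + 2) * x +
        (2 * l + 1 : ℕ) * (1 - 2 * x)) (by fun_prop))) iho
      have e2 := hmul (hMul (hratio' s) (hbdd (fun x => (2 * l + 1) * (x * (1 - x)))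
        (by fun_prop))) ihe
      have e3 := hmul (hbdd (fun x => (2 * l + 1) * d * (x * (1 - x)) ^ (l + 1))
        (by fun_prop)) (hratio s)
      refine ((e1.add e2).add e3).congr' ?_ EventuallyEq.rfl
      filter_upwards [hrec (2 * l + 1)] with z hz
      have hr := hz.2
      rw [hd', show 2 * (l + 1) = 2 * l + 1 + 1 by ring, hr, Nat.add_sub_cancel, ← hs]
      have := hz.1.ne'
      rw [← hs] at this
      push_cast
      field_simp
      ring
    refine ⟨heven, ?_⟩
    have hbig : (fun z : ℕ × ℝ => (z.1 : ℝ) ^ (l + 1) * TE z.1 α β (2 * (l + 1)) z.2)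
        =O[L] (fun _ => (1:ℝ)) :=
      (heven.isBigO.add (hbdd (fun x => (Nat.doubleFactorial (2 * (l + 1) - 1) : ℝ) *
        (x * (1 - x)) ^ (l + 1)) (by fun_prop))).congr_left fun z => by ring
    set s : ℝ := α + β + 2 + (2 * (l + 1) : ℕ) with hs
    have e1 := hmul (hMul (hbdd (fun x => α + 1 - (α + β + 2) * x +
      (2 * (l + 1) : ℕ) * (1 - 2 * x)) (by fun_prop)) hbig) (hinv s)
    have e2 := hmul (hMul (hratio' s) (hbdd (fun x => (2 * (l + 1) : ℕ) * (x * (1 - x)))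
      (by fun_prop))) iho
    refine (e1.add e2).congr' ?_ EventuallyEq.rfl
    filter_upwards [hrec (2 * (l + 1))] with z hz
    rw [hz.2, ← hs, show 2 * (l + 1) - 1 = 2 * l + 1 by omega]
    have := hz.1.ne'
    rw [← hs] at this
    field_simp
    ring

theorem even_moment_asymptotics (α β : ℝ) (hα : α ≥ -1) (hβ : β ≥ -1)
    (l : ℕ) (hl : 1 ≤ l) :
    TendstoUniformlyOn (fun (n : ℕ) (x : ℝ) => (n : ℝ) ^ l * TE n α β (2 * l) x)
      (fun x => (Nat.doubleFactorial (2 * l - 1) : ℝ) * (x * (1 - x)) ^ l) atTop (Set.Icc (0:ℝ) 1) := by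
  have h := (Asymptotics.isLittleO_one_iff ℝ).1 (central_moment_asymptotics hα hβ l).1
  rw [Metric.tendstoUniformlyOn_iff]
  intro ε hε
  have h' := (Metric.tendsto_nhds.1 h) ε hε
  rw [eventually_prod_principal_iff] at h'
  filter_upwards [h'] with n hn x hx
  rw [dist_comm, Real.dist_eq]
  simpa [Real.dist_eq] using hn x hx
end

section
/- (Voronovskaya-type theorem) Let α, β ≥ -1 and f ∈ C²[0,1]. Then lim_{n→∞} n·[B_n^{α,β}(f; x) - f(x)] = (x(1-x)/2)·f''(x) + [α+1-(α+β+2)x]·f'(x), uniformly for x ∈ [0,1]. -/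
open MeasureTheory intervalIntegral Filter

/-- The mean of `g` with respect to the normalized Jacobi weight `t ^ p * (1 - t) ^ q`
on `[0, 1]`. -/
noncomputable def jacobiMean (p q : ℝ) (g : ℝ → ℝ) : ℝ :=
  (∫ t in (0:ℝ)..1, t ^ p * (1 - t) ^ q * g t) / (∫ t in (0:ℝ)..1, t ^ p * (1 - t) ^ q)

section JacobiMean

variable {p q : ℝ}

theorem intervalIntegrable_jacobiWeight (hp : -1 < p) (hq : -1 < q) :
    IntervalIntegrable (fun t : ℝ => t ^ p * (1 - t) ^ q) volume 0 1 := by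
  have h := Complex.betaIntegral_convergent (u := ((p + 1 : ℝ) : ℂ)) (v := ((q + 1 : ℝ) : ℂ))
    (by rw [Complex.ofReal_re]; linarith) (by rw [Complex.ofReal_re]; linarith)
  rw [intervalIntegrable_iff_integrableOn_Ioc_of_le zero_le_one] at h ⊢
  refine (h.re).congr ?_
  filter_upwards [ae_restrict_mem measurableSet_Ioc] with t ht
  have h1 : ((t : ℂ) ^ (((p + 1 : ℝ) : ℂ) - 1)) = ((t ^ p : ℝ) : ℂ) := by
    rw [Complex.ofReal_cpow ht.1.le]; push_cast; ring_nf
  have h2 : ((1 - (t : ℂ)) ^ (((q + 1 : ℝ) : ℂ) - 1)) = (((1 - t) ^ q : ℝ) : ℂ) := by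
    rw [Complex.ofReal_cpow (by linarith [ht.2])]; push_cast; ring_nf
  rw [h1, h2, ← Complex.ofReal_mul]
  simp

theorem integral_jacobiWeight (hp : -1 < p) (hq : -1 < q) :
    ∫ t in (0:ℝ)..1, t ^ p * (1 - t) ^ q = ProbabilityTheory.beta (p + 1) (q + 1) := by
  rw [ProbabilityTheory.beta_eq_betaIntegralReal _ _ (by linarith) (by linarith),
    Complex.betaIntegral]
  have h : ∫ t in (0:ℝ)..1, (t : ℂ) ^ (((p + 1 : ℝ) : ℂ) - 1) *
      (1 - (t : ℂ)) ^ (((q + 1 : ℝ) : ℂ) - 1) =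
      ∫ t in (0:ℝ)..1, ((t ^ p * (1 - t) ^ q : ℝ) : ℂ) := by
    refine intervalIntegral.integral_congr fun t ht => ?_
    rw [Set.uIcc_of_le zero_le_one] at ht
    have h1 : ((t : ℂ) ^ (((p + 1 : ℝ) : ℂ) - 1)) = ((t ^ p : ℝ) : ℂ) := by
      rw [Complex.ofReal_cpow ht.1]; push_cast; ring_nf
    have h2 : ((1 - (t : ℂ)) ^ (((q + 1 : ℝ) : ℂ) - 1)) = (((1 - t) ^ q : ℝ) : ℂ) := by
      rw [Complex.ofReal_cpow (by linarith [ht.2])]; push_cast; ring_nf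
    simp only [h1, h2, ← Complex.ofReal_mul]
  rw [h, intervalIntegral.integral_ofReal, Complex.ofReal_re]

theorem integral_jacobiWeight_pos (hp : -1 < p) (hq : -1 < q) :
    0 < ∫ t in (0:ℝ)..1, t ^ p * (1 - t) ^ q := by
  rw [integral_jacobiWeight hp hq]
  exact ProbabilityTheory.beta_pos (by linarith) (by linarith)

theorem intervalIntegrable_jacobiWeight_mul (hp : -1 < p) (hq : -1 < q) {g : ℝ → ℝ}
    (hg : ContinuousOn g (Set.Icc 0 1)) :
    IntervalIntegrable (fun t : ℝ => t ^ p * (1 - t) ^ q * g t) volume 0 1 :=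
  (intervalIntegrable_jacobiWeight hp hq).mul_continuousOn
    (by rwa [Set.uIcc_of_le zero_le_one])

theorem jacobiMean_add (hp : -1 < p) (hq : -1 < q) {g h : ℝ → ℝ}
    (hg : ContinuousOn g (Set.Icc 0 1)) (hh : ContinuousOn h (Set.Icc 0 1)) :
    jacobiMean p q (fun t => g t + h t) = jacobiMean p q g + jacobiMean p q h := by
  unfold jacobiMean
  rw [← add_div, ← intervalIntegral.integral_add (intervalIntegrable_jacobiWeight_mul hp hq hg)
    (intervalIntegrable_jacobiWeight_mul hp hq hh)]
  simp only [mul_add]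

theorem jacobiMean_const_mul (c : ℝ) (g : ℝ → ℝ) :
    jacobiMean p q (fun t => c * g t) = c * jacobiMean p q g := by
  unfold jacobiMean
  rw [← mul_div_assoc, ← intervalIntegral.integral_const_mul]
  simp only [mul_left_comm]

theorem jacobiMean_sub (hp : -1 < p) (hq : -1 < q) {g h : ℝ → ℝ}
    (hg : ContinuousOn g (Set.Icc 0 1)) (hh : ContinuousOn h (Set.Icc 0 1)) :
    jacobiMean p q (fun t => g t - h t) = jacobiMean p q g - jacobiMean p q h := by
  unfold jacobiMean
  rw [← sub_div, ← intervalIntegral.integral_sub (intervalIntegrable_jacobiWeight_mul hp hq hg)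
    (intervalIntegrable_jacobiWeight_mul hp hq hh)]
  simp only [mul_sub]

theorem abs_jacobiMean_le (hp : -1 < p) (hq : -1 < q) {g h : ℝ → ℝ}
    (hh : ContinuousOn h (Set.Icc 0 1)) (hgh : ∀ t ∈ Set.Icc (0:ℝ) 1, |g t| ≤ h t) :
    |jacobiMean p q g| ≤ jacobiMean p q h := by
  unfold jacobiMean
  have hpos := integral_jacobiWeight_pos hp hq
  rw [abs_div, abs_of_pos hpos]
  refine div_le_div_of_nonneg_right ?_ hpos.le
  rw [← Real.norm_eq_abs]
  refine intervalIntegral.norm_integral_le_of_norm_le zero_le_one ?_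
    (intervalIntegrable_jacobiWeight_mul hp hq hh)
  refine Eventually.of_forall fun t ht => ?_
  have hw : 0 ≤ t ^ p * (1 - t) ^ q :=
    mul_nonneg (Real.rpow_nonneg ht.1.le _) (Real.rpow_nonneg (by linarith [ht.2]) _)
  rw [norm_mul, Real.norm_of_nonneg hw]
  exact mul_le_mul_of_nonneg_left (hgh t ⟨ht.1.le, ht.2⟩) hw

theorem integral_jacobiWeight_mul_pow (hp : -1 < p) (hq : -1 < q) (k : ℕ) :
    ∫ t in (0:ℝ)..1, t ^ p * (1 - t) ^ q * t ^ k =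
      ProbabilityTheory.beta (p + 1 + k) (q + 1) := by
  have hk : (0:ℝ) ≤ k := k.cast_nonneg
  have h : ∫ t in (0:ℝ)..1, t ^ p * (1 - t) ^ q * t ^ k =
      ∫ t in (0:ℝ)..1, t ^ (p + k) * (1 - t) ^ q := by
    refine intervalIntegral.integral_congr_ae (Eventually.of_forall fun t ht => ?_)
    rw [Set.uIoc_of_le zero_le_one] at ht
    rw [Real.rpow_add ht.1, Real.rpow_natCast]
    ring
  rw [h, integral_jacobiWeight (by linarith) hq]
  ring_nf

theorem jacobiMean_pow_zero (hp : -1 < p) (hq : -1 < q) :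
    jacobiMean p q (fun t => t ^ 0) = 1 := by
  simp only [jacobiMean, pow_zero, mul_one]
  exact div_self (integral_jacobiWeight_pos hp hq).ne'

theorem jacobiMean_pow_succ (hp : -1 < p) (hq : -1 < q) (k : ℕ) :
    jacobiMean p q (fun t => t ^ (k + 1)) =
      (p + 1 + k) / (p + q + 2 + k) * jacobiMean p q (fun t => t ^ k) := by
  have hk : (0:ℝ) ≤ k := k.cast_nonneg
  unfold jacobiMean
  rw [integral_jacobiWeight_mul_pow hp hq, integral_jacobiWeight_mul_pow hp hq, ← mul_div_assoc]
  congr 1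
  unfold ProbabilityTheory.beta
  have h1 : p + 1 + ((k + 1 : ℕ) : ℝ) = (p + 1 + k) + 1 := by push_cast; ring
  have h2 : (p + 1 + k) + 1 + (q + 1) = (p + q + 2 + k) + 1 := by ring
  have h3 : (p + 1 + k) + (q + 1) = p + q + 2 + k := by ring
  have h4 : p + q + 2 + k ≠ 0 := by linarith
  have h5 : Real.Gamma (p + q + 2 + k) ≠ 0 := (Real.Gamma_pos_of_pos (by linarith)).ne'
  rw [h1, h2, h3, Real.Gamma_add_one (by linarith), Real.Gamma_add_one h4]
  field_simp

theorem jacobiMean_quartic (hp : -1 < p) (hq : -1 < q) (c₀ c₁ c₂ c₃ c₄ : ℝ) :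
    jacobiMean p q (fun t => c₀ + c₁ * t + c₂ * t ^ 2 + c₃ * t ^ 3 + c₄ * t ^ 4) =
      c₀ + (p + 1) / (p + q + 2) * (c₁ + (p + 2) / (p + q + 3) * (c₂ + (p + 3) / (p + q + 4) *
        (c₃ + (p + 4) / (p + q + 5) * c₄))) := by
  have h0 := jacobiMean_pow_zero hp hq
  have h1 := jacobiMean_pow_succ hp hq 0
  have h2 := jacobiMean_pow_succ hp hq 1
  have h3 := jacobiMean_pow_succ hp hq 2
  have h4 := jacobiMean_pow_succ hp hq 3
  have e : (fun t : ℝ => c₀ + c₁ * t + c₂ * t ^ 2 + c₃ * t ^ 3 + c₄ * t ^ 4) =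
      fun t => c₀ * t ^ 0 + c₁ * t ^ (0 + 1) + c₂ * t ^ (1 + 1) + c₃ * t ^ (2 + 1)
        + c₄ * t ^ (3 + 1) := by
    funext t; ring
  rw [e, jacobiMean_add hp hq (by fun_prop) (by fun_prop),
    jacobiMean_add hp hq (by fun_prop) (by fun_prop),
    jacobiMean_add hp hq (by fun_prop) (by fun_prop),
    jacobiMean_add hp hq (by fun_prop) (by fun_prop)]
  simp only [jacobiMean_const_mul, h4, h3, h2, h1, h0]
  rw [show p + 2 = p + 1 + 1 by ring, show p + 3 = p + 1 + 2 by ring,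
    show p + 4 = p + 1 + 3 by ring, show p + q + 3 = p + q + 2 + 1 by ring,
    show p + q + 4 = p + q + 2 + 2 by ring, show p + q + 5 = p + q + 2 + 3 by ring]
  push_cast
  simp only [add_zero]
  ring

theorem jacobiMean_quadratic (hp : -1 < p) (hq : -1 < q) (x c₀ c₁ c₂ : ℝ) :
    jacobiMean p q (fun t => c₀ + c₁ * (t - x) + c₂ * (t - x) ^ 2) =
      c₀ + c₁ * ((p + 1) / (p + q + 2) - x) +
        c₂ * ((p + 1) * (q + 1) / ((p + q + 2) ^ 2 * (p + q + 3)) +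
          ((p + 1) / (p + q + 2) - x) ^ 2) := by
  have e : (fun t : ℝ => c₀ + c₁ * (t - x) + c₂ * (t - x) ^ 2) =
      fun t => (c₀ - c₁ * x + c₂ * x ^ 2) + (c₁ - 2 * c₂ * x) * t + c₂ * t ^ 2 + 0 * t ^ 3
        + 0 * t ^ 4 := by
    funext t; ring
  rw [e, jacobiMean_quartic hp hq]
  have h2 : p + q + 2 ≠ 0 := by linarith
  have h3 : p + q + 3 ≠ 0 := by linarith
  simp only [mul_zero, add_zero]
  field_simp
  ring

theorem jacobiMean_fourth_central_moment_le (hp : -1 < p) (hq : -1 < q) :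
    jacobiMean p q (fun t => (t - (p + 1) / (p + q + 2)) ^ 4) ≤ 1 / (p + q + 2) ^ 2 := by
  obtain ⟨a, rfl⟩ : ∃ a, p = a - 1 := ⟨p + 1, by ring⟩
  obtain ⟨b, rfl⟩ : ∃ b, q = b - 1 := ⟨q + 1, by ring⟩
  have ha : 0 < a := by linarith
  have hb : 0 < b := by linarith
  set m : ℝ := (a - 1 + 1) / (a - 1 + (b - 1) + 2) with hm
  have e : (fun t : ℝ => (t - m) ^ 4) =
      fun t => m ^ 4 + (-4 * m ^ 3) * t + (6 * m ^ 2) * t ^ 2 + (-4 * m) * t ^ 3 + 1 * t ^ 4 := by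
    funext t; ring
  rw [e, jacobiMean_quartic hp hq, hm]
  rw [show a - 1 + (b - 1) + 2 = a + b by ring, show a - 1 + (b - 1) + 3 = a + b + 1 by ring,
    show a - 1 + (b - 1) + 4 = a + b + 2 by ring, show a - 1 + (b - 1) + 5 = a + b + 3 by ring,
    show a - 1 + 1 = a by ring, show a - 1 + 2 = a + 1 by ring, show a - 1 + 3 = a + 2 by ring,
    show a - 1 + 4 = a + 3 by ring]
  have key : (a / (a + b)) ^ 4 + a / (a + b) * (-4 * (a / (a + b)) ^ 3 + (a + 1) / (a + b + 1) *
      (6 * (a / (a + b)) ^ 2 + (a + 2) / (a + b + 2) *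
        (-4 * (a / (a + b)) + (a + 3) / (a + b + 3) * 1))) =
      3 * (a * b) * (2 * (a + b) ^ 2 + a * b * (a + b - 6)) /
        ((a + b) ^ 4 * (a + b + 1) * (a + b + 2) * (a + b + 3)) := by
    field_simp
    ring
  rw [key, div_le_div_iff₀ (by positivity) (by positivity)]
  obtain ⟨s, hs⟩ : ∃ s, s = a + b := ⟨_, rfl⟩
  obtain ⟨u, hu⟩ : ∃ u, u = a * b := ⟨_, rfl⟩
  have hs0 : 0 < s := by rw [hs]; positivity
  have hu0 : 0 < u := by rw [hu]; positivity
  have hus : u ≤ s ^ 2 / 4 := by rw [hs, hu]; nlinarith [sq_nonneg (a - b)]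
  rw [← hs, ← hu]
  have h1 : 3 * u * (2 * s ^ 2 + u * (s - 6)) ≤ 3 * (s ^ 2 / 4) * (2 * s ^ 2 + s ^ 2 / 4 * s) := by
    have h2 : 2 * s ^ 2 + u * (s - 6) ≤ 2 * s ^ 2 + s ^ 2 / 4 * s := by nlinarith
    calc 3 * u * (2 * s ^ 2 + u * (s - 6)) ≤ 3 * u * (2 * s ^ 2 + s ^ 2 / 4 * s) := by gcongr
      _ ≤ _ := by gcongr
  calc 3 * u * (2 * s ^ 2 + u * (s - 6)) * s ^ 2
      ≤ 3 * (s ^ 2 / 4) * (2 * s ^ 2 + s ^ 2 / 4 * s) * s ^ 2 := by gcongr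
    _ = s ^ 4 * (3 / 2 * s ^ 2 + 3 / 16 * s ^ 3) := by ring
    _ ≤ s ^ 4 * ((s + 1) * (s + 2) * (s + 3)) := by
        gcongr
        nlinarith [pow_pos hs0 3, pow_pos hs0 2]
    _ = 1 * (s ^ 4 * (s + 1) * (s + 2) * (s + 3)) := by ring

theorem jacobiMean_fourth_moment_le (hp : -1 < p) (hq : -1 < q) (x : ℝ) :
    jacobiMean p q (fun t => (t - x) ^ 4) ≤
      8 * (1 / (p + q + 2) ^ 2 + ((p + 1) / (p + q + 2) - x) ^ 4) := by
  set m : ℝ := (p + 1) / (p + q + 2) with hm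
  have h1 : |jacobiMean p q (fun t => (t - x) ^ 4)| ≤
      jacobiMean p q (fun t => 8 * (t - m) ^ 4 + 8 * (m - x) ^ 4 * t ^ 0) := by
    refine abs_jacobiMean_le hp hq (by fun_prop) fun t _ => ?_
    rw [abs_of_nonneg (by positivity), pow_zero, mul_one]
    have h : ((t - m) + (m - x)) ^ 2 ≤ 2 * ((t - m) ^ 2 + (m - x) ^ 2) := add_sq_le
    calc (t - x) ^ 4 = (((t - m) + (m - x)) ^ 2) ^ 2 := by ring
      _ ≤ (2 * ((t - m) ^ 2 + (m - x) ^ 2)) ^ 2 := by gcongr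
      _ ≤ 8 * (t - m) ^ 4 + 8 * (m - x) ^ 4 := by
        nlinarith [sq_nonneg ((t - m) ^ 2 - (m - x) ^ 2)]
  rw [jacobiMean_add hp hq (by fun_prop) (by fun_prop), jacobiMean_const_mul,
    jacobiMean_const_mul, jacobiMean_pow_zero hp hq] at h1
  have h2 := jacobiMean_fourth_central_moment_le hp hq
  linarith [le_abs_self (jacobiMean p q (fun t => (t - x) ^ 4))]

end JacobiMean

theorem exists_taylor_remainder_bound {f f' f'' : ℝ → ℝ}
    (hf : ∀ x ∈ Set.Icc (0:ℝ) 1, HasDerivWithinAt f (f' x) (Set.Icc 0 1) x)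
    (hf' : ∀ x ∈ Set.Icc (0:ℝ) 1, HasDerivWithinAt f' (f'' x) (Set.Icc 0 1) x)
    (hf'' : ContinuousOn f'' (Set.Icc 0 1)) {ε : ℝ} (hε : 0 < ε) :
    ∃ C, 0 ≤ C ∧ ∀ x ∈ Set.Icc (0:ℝ) 1, ∀ t ∈ Set.Icc (0:ℝ) 1,
      |f t - (f x + f' x * (t - x) + f'' x / 2 * (t - x) ^ 2)| ≤
        ε * (t - x) ^ 2 + C * (t - x) ^ 4 := by
  obtain ⟨M, hM⟩ := isCompact_Icc.exists_bound_of_continuousOn hf''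
  have hM0 : 0 ≤ M := (norm_nonneg _).trans (hM 0 (by simp))
  obtain ⟨δ, hδ, hfδ⟩ := Metric.uniformContinuousOn_iff.1
    (isCompact_Icc.uniformContinuousOn_of_continuous hf'') ε hε
  have key : ∀ x ∈ Set.Icc (0:ℝ) 1, ∀ t ∈ Set.Icc (0:ℝ) 1, ∀ η : ℝ, 0 ≤ η →
      (∀ s ∈ Set.uIcc x t, |f'' s - f'' x| ≤ η) →
      |f t - (f x + f' x * (t - x) + f'' x / 2 * (t - x) ^ 2)| ≤ η * (t - x) ^ 2 := by
    intro x hx t ht η hη hb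
    have hsub : Set.uIcc x t ⊆ Set.Icc 0 1 := Set.uIcc_subset_Icc hx ht
    have hd1 : ∀ s ∈ Set.uIcc x t, |f' s - f' x - f'' x * (s - x)| ≤ η * |t - x| := by
      intro s hs
      have h := (convex_uIcc x t).norm_image_sub_le_of_norm_hasDerivWithin_le
        (f := fun s => f' s - f' x - f'' x * (s - x)) (f' := fun s => f'' s - f'' x) (C := η)
        (fun s hs => by
          have h2 := ((hf' s (hsub hs)).mono hsub).sub_const (f' x) |>.sub
            (((hasDerivWithinAt_id s (Set.uIcc x t)).sub_const x).const_mul (f'' x))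
          exact h2.congr_deriv (by simp))
        hb Set.left_mem_uIcc hs
      simp only [sub_self, mul_zero, sub_zero, Real.norm_eq_abs] at h
      exact h.trans (mul_le_mul_of_nonneg_left (Set.abs_sub_left_of_mem_uIcc hs) hη)
    have h := (convex_uIcc x t).norm_image_sub_le_of_norm_hasDerivWithin_le
      (f := fun s => f s - (f x + f' x * (s - x) + f'' x / 2 * (s - x) ^ 2))
      (f' := fun s => f' s - f' x - f'' x * (s - x)) (C := η * |t - x|)
      (fun s hs => by
        have h2 := ((hf s (hsub hs)).mono hsub).sub
          (((((hasDerivWithinAt_id s (Set.uIcc x t)).sub_const x).const_mul (f' x)).const_add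
            (f x)).add
          ((((hasDerivWithinAt_id s (Set.uIcc x t)).sub_const x).pow 2).const_mul (f'' x / 2)))
        exact h2.congr_deriv (by simp; ring))
      hd1 Set.left_mem_uIcc Set.right_mem_uIcc
    simp only [sub_self, mul_zero, add_zero, Real.norm_eq_abs, ne_eq, OfNat.ofNat_ne_zero,
      not_false_eq_true, zero_pow, sub_zero] at h
    rwa [mul_assoc, ← sq, sq_abs] at h
  refine ⟨2 * M / δ ^ 2, by positivity, fun x hx t ht => ?_⟩
  by_cases hxt : |t - x| < δ
  · refine (key x hx t ht ε hε.le fun s hs => ?_).trans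
      (le_add_of_nonneg_right (by positivity))
    have h := hfδ s (Set.uIcc_subset_Icc hx ht hs) x hx
      ((Set.abs_sub_left_of_mem_uIcc hs).trans_lt hxt)
    exact h.le
  · have h1 := key x hx t ht (2 * M) (by positivity) fun s hs => by
      have h2 := hM s (Set.uIcc_subset_Icc hx ht hs)
      have h3 := hM x hx
      rw [Real.norm_eq_abs] at h2 h3
      linarith [abs_sub (f'' s) (f'' x)]
    have h2 : δ ^ 2 ≤ (t - x) ^ 2 := by
      rw [← sq_abs (t - x)]
      exact pow_le_pow_left₀ hδ.le (not_lt.1 hxt) 2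
    have h3 : 2 * M * (t - x) ^ 2 ≤ 2 * M / δ ^ 2 * (t - x) ^ 4 := by
      rw [div_mul_eq_mul_div, le_div_iff₀ (by positivity)]
      calc 2 * M * (t - x) ^ 2 * δ ^ 2 ≤ 2 * M * (t - x) ^ 2 * (t - x) ^ 2 := by gcongr
        _ = 2 * M * (t - x) ^ 4 := by ring
    have h4 : 0 ≤ ε * (t - x) ^ 2 := by positivity
    linarith


theorem abs_jacobiMean_sub_voronovskaya_le {α β n x ε C M₁ M₂ a₁ a₂ : ℝ} {f : ℝ → ℝ}
    (hα : -1 ≤ α) (hβ : -1 ≤ β) (hn : 1 ≤ n) (hx : x ∈ Set.Icc (0:ℝ) 1)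
    (hp : -1 < n * x + α) (hq : -1 < n - n * x + β)
    (hε : 0 ≤ ε) (hC : 0 ≤ C) (ha₁ : |a₁| ≤ M₁) (ha₂ : |a₂| ≤ M₂)
    (hf : ContinuousOn f (Set.Icc 0 1))
    (hr : ∀ t ∈ Set.Icc (0:ℝ) 1, |f t - (f x + a₁ * (t - x) + a₂ / 2 * (t - x) ^ 2)| ≤
      ε * (t - x) ^ 2 + C * (t - x) ^ 4) :
    |n * (jacobiMean (n * x + α) (n - n * x + β) f - f x) -
        (x * (1 - x) / 2 * a₂ + (α + 1 - (α + β + 2) * x) * a₁)| ≤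
      ε + (M₁ * (α + β + 2) ^ 2 +
        (M₂ / 2 + ε) * (1 + 2 * (α + β + 2) + 2 * (α + β + 2) ^ 2) +
        8 * C * (1 + (α + β + 2) ^ 4)) / n := by
  obtain ⟨hx0, hx1⟩ := hx
  have hn0 : 0 < n := by linarith
  obtain ⟨c, hc⟩ : ∃ c, c = α + β + 2 := ⟨_, rfl⟩
  have hc0 : 0 ≤ c := by linarith
  obtain ⟨A, hA⟩ : ∃ A, A = α + 1 - c * x := ⟨_, rfl⟩
  have hAc : |A| ≤ c := by
    rw [hA, hc, abs_le]
    constructor <;> nlinarith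
  have hA2 : A ^ 2 ≤ c ^ 2 := by rw [← sq_abs]; gcongr
  have hA4 : A ^ 4 ≤ c ^ 4 := by
    calc A ^ 4 = (A ^ 2) ^ 2 := by ring
      _ ≤ (c ^ 2) ^ 2 := by gcongr
      _ = c ^ 4 := by ring
  have hN : n * x + α + (n - n * x + β) + 2 = n + c := by rw [hc]; ring
  have hN1 : n * x + α + (n - n * x + β) + 3 = n + c + 1 := by rw [hc]; ring
  have hNn : n ≤ n + c := by linarith
  have hN0 : 0 < n + c := by linarith
  have hd : (n * x + α + 1) / (n + c) - x = A / (n + c) := by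
    rw [hA]; field_simp; ring
  obtain ⟨V, hV⟩ : ∃ V, V = (n * x + α + 1) * (n - n * x + β + 1) / ((n + c) ^ 2 * (n + c + 1)) +
      (A / (n + c)) ^ 2 := ⟨_, rfl⟩
  have hquad (c₀ c₁ c₂ : ℝ) : jacobiMean (n * x + α) (n - n * x + β)
      (fun t => c₀ + c₁ * (t - x) + c₂ * (t - x) ^ 2) = c₀ + c₁ * (A / (n + c)) + c₂ * V := by
    rw [jacobiMean_quadratic hp hq, hN, hN1, hd, hV]
  have hfour := jacobiMean_fourth_moment_le hp hq x
  rw [hN, hd] at hfour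
  have hmain : |jacobiMean (n * x + α) (n - n * x + β) f -
      (f x + a₁ * (A / (n + c)) + a₂ / 2 * V)| ≤
      ε * V + C * (8 * (1 / (n + c) ^ 2 + (A / (n + c)) ^ 4)) := by
    have h := abs_jacobiMean_le hp hq (h := fun t => ε * (t - x) ^ 2 + C * (t - x) ^ 4)
      (by fun_prop) hr
    rw [jacobiMean_sub hp hq hf (by fun_prop), hquad,
      jacobiMean_add hp hq (by fun_prop) (by fun_prop), jacobiMean_const_mul _ fun t => (t - x) ^ 4]
      at h
    have h2 := hquad 0 0 ε
    simp only [zero_mul, zero_add] at h2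
    rw [h2] at h
    exact h.trans (by gcongr)
  have hfirst : |n * (A / (n + c)) - A| ≤ c ^ 2 / n := by
    have e : n * (A / (n + c)) - A = -(A * c / (n + c)) := by field_simp; ring
    rw [e, abs_neg, abs_div, abs_mul, abs_of_nonneg hc0, abs_of_pos hN0, sq]
    gcongr
  have hxx : 0 ≤ x * (1 - x) := mul_nonneg hx0 (by linarith)
  have hxx1 : x * (1 - x) ≤ 1 := by nlinarith
  have hsecond : |n * V - x * (1 - x)| ≤ (1 + 2 * c + 2 * c ^ 2) / n := by
    have e : n * V - x * (1 - x) = -(x * (1 - x) * ((c + 1) / (n + c + 1))) +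
        (n / (n + c + 1) * (A * (1 - 2 * x) / (n + c)) - n / (n + c + 1) * (A ^ 2 / (n + c) ^ 2)) +
        n * A ^ 2 / (n + c) ^ 2 := by
      have h3 : n + c + 1 ≠ 0 := by linarith
      have e1 : n * x + α + 1 = (n + c) * x + A := by rw [hA]; ring
      have e2 : n - n * x + β + 1 = (n + c) * (1 - x) - A := by rw [hA, hc]; ring
      rw [hV, e1, e2]
      field_simp
      ring
    have hn1 : n / (n + c + 1) ≤ 1 := by rw [div_le_one (by linarith)]; linarith
    have hn1' : 0 ≤ n / (n + c + 1) := by positivity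
    have b1 : |x * (1 - x) * ((c + 1) / (n + c + 1))| ≤ (c + 1) / n := by
      rw [abs_of_nonneg (by positivity)]
      calc x * (1 - x) * ((c + 1) / (n + c + 1)) ≤ 1 * ((c + 1) / n) := by
            gcongr
            linarith
        _ = _ := one_mul _
    have b2 : |n / (n + c + 1) * (A * (1 - 2 * x) / (n + c))| ≤ c / n := by
      rw [abs_mul, abs_of_nonneg hn1', abs_div, abs_mul, abs_of_pos hN0]
      have : |1 - 2 * x| ≤ 1 := by rw [abs_le]; constructor <;> linarith
      calc n / (n + c + 1) * (|A| * |1 - 2 * x| / (n + c)) ≤ 1 * (c * 1 / n) := by gcongr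
        _ = _ := by ring
    have b4 : n * A ^ 2 / (n + c) ^ 2 ≤ c ^ 2 / n := by
      calc n * A ^ 2 / (n + c) ^ 2 ≤ n * c ^ 2 / n ^ 2 := by gcongr
        _ = _ := by field_simp
    have b3 : n / (n + c + 1) * (A ^ 2 / (n + c) ^ 2) ≤ c ^ 2 / n := by
      refine le_trans ?_ b4
      rw [mul_div_assoc]
      gcongr
      exact div_le_self hn0.le (by linarith)
    have b3' : 0 ≤ n / (n + c + 1) * (A ^ 2 / (n + c) ^ 2) := by positivity
    have b4' : 0 ≤ n * A ^ 2 / (n + c) ^ 2 := by positivity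
    have e5 : (1 + 2 * c + 2 * c ^ 2) / n = (c + 1) / n + c / n + c ^ 2 / n + c ^ 2 / n := by ring
    rw [e, e5, abs_le]
    rw [abs_le] at b1 b2
    constructor <;> linarith
  have hthird : n * (1 / (n + c) ^ 2 + (A / (n + c)) ^ 4) ≤ (1 + c ^ 4) / n := by
    have g1 : n * (1 / (n + c) ^ 2) ≤ 1 / n := by
      calc n * (1 / (n + c) ^ 2) ≤ n * (1 / n ^ 2) := by gcongr
        _ = _ := by field_simp
    have g2 : n * (A / (n + c)) ^ 4 ≤ c ^ 4 / n := by
      rw [div_pow]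
      calc n * (A ^ 4 / (n + c) ^ 4) ≤ n * (c ^ 4 / n ^ 4) := by gcongr
        _ = c ^ 4 / n ^ 3 := by field_simp
        _ ≤ c ^ 4 / n := by
          gcongr
          exact le_self_pow₀ hn (by norm_num)
    rw [mul_add, add_div]
    linarith
  rw [← hc, ← hA]
  have hdecomp : n * (jacobiMean (n * x + α) (n - n * x + β) f - f x) -
      (x * (1 - x) / 2 * a₂ + A * a₁) =
      n * (jacobiMean (n * x + α) (n - n * x + β) f - (f x + a₁ * (A / (n + c)) + a₂ / 2 * V)) +
      a₁ * (n * (A / (n + c)) - A) + a₂ / 2 * (n * V - x * (1 - x)) := by ring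
  have t1 : |n * (jacobiMean (n * x + α) (n - n * x + β) f -
      (f x + a₁ * (A / (n + c)) + a₂ / 2 * V))| ≤
      ε * (1 + (1 + 2 * c + 2 * c ^ 2) / n) + 8 * C * ((1 + c ^ 4) / n) := by
    rw [abs_mul, abs_of_pos hn0]
    calc _ ≤ n * (ε * V + C * (8 * (1 / (n + c) ^ 2 + (A / (n + c)) ^ 4))) := by gcongr
      _ = ε * (n * V) + 8 * C * (n * (1 / (n + c) ^ 2 + (A / (n + c)) ^ 4)) := by ring
      _ ≤ _ := by
        gcongr
        linarith [(abs_le.1 hsecond).2]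
  have t2 : |a₁ * (n * (A / (n + c)) - A)| ≤ M₁ * (c ^ 2 / n) := by
    rw [abs_mul]
    exact mul_le_mul ha₁ hfirst (abs_nonneg _) ((abs_nonneg _).trans ha₁)
  have t3 : |a₂ / 2 * (n * V - x * (1 - x))| ≤ M₂ / 2 * ((1 + 2 * c + 2 * c ^ 2) / n) := by
    rw [abs_mul, abs_div, abs_two]
    exact mul_le_mul (by linarith) hsecond (abs_nonneg _)
      (by linarith [(abs_nonneg a₂).trans ha₂])
  rw [hdecomp]
  refine (abs_add_three _ _ _).trans ((add_le_add_three t1 t2 t3).trans (le_of_eq ?_))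
  ring

theorem voronovskaya (α β : ℝ) (hα : α ≥ -1) (hβ : β ≥ -1)
    (f : ℝ → ℝ) (hf : ContDiffOn ℝ 2 f (Set.Icc (0:ℝ) 1)) :
    TendstoUniformlyOn (fun (n : ℕ) (x : ℝ) => (n : ℝ) * (BopE n α β f x - f x))
      (fun x => x * (1 - x) / 2 * iteratedDerivWithin 2 f (Set.Icc (0:ℝ) 1) x +
        (α + 1 - (α + β + 2) * x) * iteratedDerivWithin 1 f (Set.Icc (0:ℝ) 1) x)
      atTop (Set.Icc (0:ℝ) 1) := by
  have hu : UniqueDiffOn ℝ (Set.Icc (0:ℝ) 1) := uniqueDiffOn_Icc zero_lt_one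
  have hf₁ : ∀ x ∈ Set.Icc (0:ℝ) 1,
      HasDerivWithinAt f (iteratedDerivWithin 1 f (Set.Icc 0 1) x) (Set.Icc 0 1) x := by
    intro x hx
    rw [iteratedDerivWithin_one]
    exact (hf.differentiableOn two_ne_zero x hx).hasDerivWithinAt
  have hf₂ : ∀ x ∈ Set.Icc (0:ℝ) 1, HasDerivWithinAt (iteratedDerivWithin 1 f (Set.Icc 0 1))
      (iteratedDerivWithin 2 f (Set.Icc 0 1) x) (Set.Icc 0 1) x := by
    intro x hx
    rw [iteratedDerivWithin_succ (n := 1)]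
    exact (hf.differentiableOn_iteratedDerivWithin (m := 1) (by norm_cast) hu x
      hx).hasDerivWithinAt
  have hc₁ := hf.continuousOn_iteratedDerivWithin (m := 1) (by norm_cast) hu
  have hc₂ := hf.continuousOn_iteratedDerivWithin (m := 2) le_rfl hu
  obtain ⟨M₁, hM₁⟩ := isCompact_Icc.exists_bound_of_continuousOn hc₁
  obtain ⟨M₂, hM₂⟩ := isCompact_Icc.exists_bound_of_continuousOn hc₂
  rw [Metric.tendstoUniformlyOn_iff]
  intro ε hε
  obtain ⟨C, hC, hr⟩ := exists_taylor_remainder_bound hf₁ hf₂ hc₂ (half_pos hε)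
  have hlim := (tendsto_const_div_atTop_nhds_zero_nat (M₁ * (α + β + 2) ^ 2 +
    (M₂ / 2 + ε / 2) * (1 + 2 * (α + β + 2) + 2 * (α + β + 2) ^ 2) +
      8 * C * (1 + (α + β + 2) ^ 4))).eventually_lt_const (half_pos hε)
  filter_upwards [hlim, eventually_ge_atTop 1] with n hnε hn x hx
  have hn' : (1:ℝ) ≤ n := by exact_mod_cast hn
  rw [dist_comm, Real.dist_eq]
  unfold BopE
  split_ifs with h0 h1
  · obtain ⟨rfl, rfl⟩ := h0
    simpa using hε
  · obtain ⟨rfl, rfl⟩ := h1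
    have e : α + 1 - (α + -1 + 2) = 0 := by ring
    simpa [e] using hε
  · have hp : -1 < n * x + α := by
      rcases hx.1.eq_or_lt with rfl | hx0
      · have : α ≠ -1 := fun h => h0 ⟨h, rfl⟩
        have := lt_of_le_of_ne hα this.symm
        simpa using this
      · have : 0 < (n:ℝ) * x := by positivity
        linarith
    have hq : -1 < n - n * x + β := by
      rcases hx.2.eq_or_lt with rfl | hx1
      · have : β ≠ -1 := fun h => h1 ⟨h, rfl⟩
        have := lt_of_le_of_ne hβ this.symm
        simpa using this
      · have : 0 < (n:ℝ) * (1 - x) := mul_pos (by linarith) (by linarith)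
        linarith
    have h := abs_jacobiMean_sub_voronovskaya_le hα hβ hn' hx hp hq (half_pos hε).le hC
      (hM₁ x hx) (hM₂ x hx) hf.continuousOn (hr x hx)
    refine lt_of_le_of_lt h ?_
    linarith
end
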